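/- arXiv:2307.04288 — 2 statements merged into one kernel-verified Lean document; each statement's English description precedes it below -/
import Mathlib

section
/- (Differential equation of the Weierstrass ℘-function.) Let Λ ⊆ ℂ be a lattice, let ℘_Λ(z) := z⁻² + ∑_{ω ∈ Λ∖{0}} ( (z−ω)⁻² − ω⁻² ) and ℘'_Λ(z) := −2 ∑_{ω ∈ Λ} (z−ω)⁻³ for z ∈ ℂ∖Λ, and set g₂(Λ) := 60 ∑_{ω ∈ Λ∖{0}} ω⁻⁴ and g₃(Λ) := 140 ∑_{ω ∈ Λ∖{0}} ω⁻⁶. Then for every z ∈ ℂ∖Λ, (℘'_Λ(z))² = 4 ℘_Λ(z)³ − g₂(Λ) ℘_Λ(z) − g₃(Λ); that is, the holomorphic map z ↦ (℘_Λ(z), ℘'_Λ(z)) takes values in the affine cubic curve { (x,y) ∈ ℂ² : y² = 4x³ − g₂(Λ)x − g₃(Λ) }. -/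
open Filter

/-- A lattice in `ℂ`: a discrete additive subgroup that spans `ℂ` as a real vector
space. -/
def IsComplexLattice (Λ : AddSubgroup ℂ) : Prop :=
  DiscreteTopology Λ ∧ Submodule.span ℝ (Λ : Set ℂ) = ⊤

/-- The nonzero elements of a lattice `Λ ⊆ ℂ`. -/
def latticeNonzero (Λ : AddSubgroup ℂ) : Type := {ω : ℂ // ω ∈ Λ ∧ ω ≠ 0}

/-- The Weierstrass ℘-function of a lattice `Λ ⊆ ℂ`:
`℘_Λ(z) = z⁻² + ∑_{ω ∈ Λ∖{0}} ((z−ω)⁻² − ω⁻²)` (junk value on `Λ`). -/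
noncomputable def wp (Λ : AddSubgroup ℂ) (z : ℂ) : ℂ :=
  (z ^ 2)⁻¹ + ∑' ω : latticeNonzero Λ, (((z - ω.1) ^ 2)⁻¹ - (ω.1 ^ 2)⁻¹)

/-- The derivative of the Weierstrass ℘-function: `℘'_Λ(z) = −2 ∑_{ω ∈ Λ} (z−ω)⁻³`. -/
noncomputable def wp' (Λ : AddSubgroup ℂ) (z : ℂ) : ℂ :=
  -2 * ∑' ω : Λ, ((z - (ω : ℂ)) ^ 3)⁻¹

/-- The Eisenstein coefficient `g₂(Λ) = 60 ∑_{ω ∈ Λ∖{0}} ω⁻⁴`. -/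
noncomputable def g2 (Λ : AddSubgroup ℂ) : ℂ :=
  60 * ∑' ω : latticeNonzero Λ, (ω.1 ^ 4)⁻¹

/-- The Eisenstein coefficient `g₃(Λ) = 140 ∑_{ω ∈ Λ∖{0}} ω⁻⁶`. -/
noncomputable def g3 (Λ : AddSubgroup ℂ) : ℂ :=
  140 * ∑' ω : latticeNonzero Λ, (ω.1 ^ 6)⁻¹

/-- Period pair of a complex lattice. -/
theorem exists_periodPair (Λ : AddSubgroup ℂ) (hΛ : IsComplexLattice Λ) :
    ∃ L : PeriodPair, ∀ x, x ∈ L.lattice ↔ x ∈ Λ := by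
  obtain ⟨h1, h2⟩ := hΛ
  let M : Submodule ℤ ℂ := AddSubgroup.toIntSubmodule Λ
  have : DiscreteTopology M := h1
  have : IsZLattice ℝ M := ⟨h2⟩
  have hr : Module.finrank ℤ M = 2 := by
    rw [ZLattice.rank ℝ M, Complex.finrank_real_complex]
  have : Module.Free ℤ M := ZLattice.module_free ℝ M
  have : Module.Finite ℤ M := ZLattice.module_finite ℝ M
  let b : Module.Basis (Fin 2) ℤ M := Module.finBasisOfFinrankEq ℤ M hr
  have hb : ∀ i, b.ofZLatticeBasis ℝ M i = (b i : ℂ) := fun i => b.ofZLatticeBasis_apply ℝ M i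
  refine ⟨⟨b 0, b 1, ?_⟩, ?_⟩
  · have := (b.ofZLatticeBasis ℝ M).linearIndependent
    have hf : (![(b 0 : ℂ), (b 1 : ℂ)]) = b.ofZLatticeBasis ℝ M := by
      funext i
      fin_cases i <;> simp [hb]
    rw [hf]
    exact this
  · intro x
    have := b.ofZLatticeBasis_span ℝ M
    have hx : x ∈ M ↔ x ∈ Λ := Iff.rfl
    have hs : Set.range (b.ofZLatticeBasis ℝ M) = {(b 0 : ℂ), (b 1 : ℂ)} := by
      ext y
      simp [hb, Fin.exists_fin_two, eq_comm]
    rw [hs] at this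
    have hm : x ∈ Submodule.span ℤ {(b 0 : ℂ), (b 1 : ℂ)} ↔ x ∈ M :=
      Eq.to_iff (congrArg (fun N : Submodule ℤ ℂ => x ∈ N) this)
    exact hm.trans hx

/-- Sum over nonzero elements agrees with sum over all if the term at zero vanishes. -/
theorem tsum_latticeNonzero (Λ : AddSubgroup ℂ) (f : ℂ → ℂ) (h0 : f 0 = 0) :
    ∑' ω : latticeNonzero Λ, f ω.1 = ∑' ω : Λ, f ω := by
  let i : latticeNonzero Λ → Λ := fun w => ⟨w.1, w.2.1⟩
  have hi : Function.Injective i := fun a b h =>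
    Subtype.ext (congrArg (fun w : Λ => (w : ℂ)) h)
  refine hi.tsum_eq (f := fun ω : Λ => f ω) ?_
  intro w hw
  have : (w : ℂ) ≠ 0 := by
    intro h
    exact hw (by simp [h, h0])
  exact ⟨⟨w, w.2, this⟩, rfl⟩

/-- Differential equation of the Weierstrass ℘-function: for every `z ∈ ℂ∖Λ`,
`(℘'_Λ(z))² = 4 ℘_Λ(z)³ − g₂(Λ) ℘_Λ(z) − g₃(Λ)`; that is, `z ↦ (℘_Λ(z), ℘'_Λ(z))`
takes values in the affine cubic `{(x,y) : y² = 4x³ − g₂(Λ)x − g₃(Λ)}`. -/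
theorem wp_differential_equation (Λ : AddSubgroup ℂ) (hΛ : IsComplexLattice Λ)
    (z : ℂ) (hz : z ∉ Λ) :
    (wp' Λ z) ^ 2 = 4 * (wp Λ z) ^ 3 - g2 Λ * wp Λ z - g3 Λ := by
  obtain ⟨L, hL⟩ := exists_periodPair Λ hΛ
  let e : L.lattice ≃ Λ := Equiv.subtypeEquivRight hL
  have key := L.derivWeierstrassP_sq z (fun h => hz ((hL z).1 h))
  have hG : ∀ n : ℕ, n ≠ 0 → ∑' ω : latticeNonzero Λ, (ω.1 ^ n)⁻¹ = L.G n := by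
    intro n hn
    rw [tsum_latticeNonzero Λ (fun w => (w ^ n)⁻¹) (by simp [hn])]
    exact (e.tsum_eq (fun w : Λ => ((w : ℂ) ^ n)⁻¹)).symm
  have h2 : g2 Λ = L.g₂ := by rw [g2, PeriodPair.g₂, hG 4 (by norm_num)]
  have h3 : g3 Λ = L.g₃ := by rw [g3, PeriodPair.g₃, hG 6 (by norm_num)]
  have hp' : wp' Λ z = L.derivWeierstrassP z := by
    rw [wp', PeriodPair.derivWeierstrassP, ← e.tsum_eq, ← tsum_mul_left, ← tsum_neg]
    refine tsum_congr fun l => ?_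
    change -2 * ((z - (l : ℂ)) ^ 3)⁻¹ = -(2 / (z - (l : ℂ)) ^ 3)
    ring
  have hp : wp Λ z = L.weierstrassP z := by
    have hs : Summable fun l : L.lattice => (1 / (z - (l : ℂ)) ^ 2 - 1 / (l : ℂ) ^ 2) :=
      (L.hasSum_weierstrassP z).summable
    rw [wp, PeriodPair.weierstrassP, hs.tsum_eq_add_tsum_ite 0]
    congr 1
    · simp
    · have := tsum_latticeNonzero Λ
        (fun w => if w = 0 then 0 else ((z - w) ^ 2)⁻¹ - (w ^ 2)⁻¹) (by simp)
      rw [← e.tsum_eq] at this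
      convert this using 1
      · refine tsum_congr fun w => ?_
        rw [if_neg w.2.2]
      · refine tsum_congr fun l => ?_
        have hl : ((e l : Λ) : ℂ) = l := rfl
        simp [hl]
  rw [hp', hp, h2, h3]
  exact key
end

section
/- (Nonvanishing of the discriminant.) Let Λ ⊆ ℂ be a lattice and set g₂(Λ) := 60 ∑_{ω ∈ Λ∖{0}} ω⁻⁴ and g₃(Λ) := 140 ∑_{ω ∈ Λ∖{0}} ω⁻⁶. Then the discriminant Δ(Λ) := g₂(Λ)³ − 27 g₃(Λ)² is nonzero; equivalently, the cubic polynomial 4x³ − g₂(Λ)x − g₃(Λ) has no repeated roots. -/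
open UpperHalfPlane ModularForm EisensteinSeries in
lemma exists_param (Λ : AddSubgroup ℂ) (hΛ : IsComplexLattice Λ) :
    ∃ (ω : ℂ) (τ : UpperHalfPlane) (e : (Fin 2 → ℤ) ≃ Λ), ω ≠ 0 ∧
      ∀ v, (e v : ℂ) = ω * (v 0 * (τ : ℂ) + v 1) := by
  obtain ⟨h1, h2⟩ := hΛ
  let L : Submodule ℤ ℂ := Λ.toIntSubmodule
  haveI : DiscreteTopology L := h1
  haveI : IsZLattice ℝ L := ⟨h2⟩
  have key : ∀ b : Module.Basis (Fin 2) ℤ L, 0 < ((b 0 : ℂ) / (b 1 : ℂ)).im →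
      ∃ (ω : ℂ) (τ : UpperHalfPlane) (e : (Fin 2 → ℤ) ≃ Λ), ω ≠ 0 ∧
      ∀ v, (e v : ℂ) = ω * (v 0 * (τ : ℂ) + v 1) := by
    intro b hb
    have hb1 : (b 1 : ℂ) ≠ 0 := by
      intro h
      simp [h] at hb
    refine ⟨b 1, ⟨_, hb⟩, b.equivFun.symm.toEquiv, hb1, fun v => ?_⟩
    have : ((b.equivFun.symm v : L) : ℂ) = v 0 * (b 0 : ℂ) + v 1 * (b 1 : ℂ) := by
      simp [Module.Basis.equivFun_symm_apply]
    refine Eq.trans this ?_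
    change _ = (b 1 : ℂ) * (v 0 * ((b 0 : ℂ) / (b 1 : ℂ)) + v 1)
    field_simp
  haveI := ZLattice.module_finite ℝ L
  haveI := ZLattice.module_free ℝ L
  let b : Module.Basis (Fin 2) ℤ L := Module.finBasisOfFinrankEq ℤ L
    (by rw [ZLattice.rank ℝ L, Complex.finrank_real_complex])
  have hli := (b.ofZLatticeBasis ℝ L).linearIndependent
  have hb0 : (b 0 : ℂ) ≠ 0 := by
    simpa using b.ne_zero 0
  have hb1 : (b 1 : ℂ) ≠ 0 := by
    simpa using b.ne_zero 1
  rcases lt_trichotomy ((b 0 : ℂ) / (b 1 : ℂ)).im 0 with h | h | h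
  · apply key (b.reindex (Equiv.swap 0 1))
    simp only [Module.Basis.reindex_apply, Equiv.symm_swap, Equiv.swap_apply_left,
      Equiv.swap_apply_right]
    rw [← inv_div, Complex.inv_im]
    have : (b 0 : ℂ) / (b 1 : ℂ) ≠ 0 := div_ne_zero hb0 hb1
    have := Complex.normSq_pos.2 this
    exact div_pos (by linarith) this
  · exfalso
    have hr : ((((b 0 : ℂ) / (b 1 : ℂ)).re : ℝ) : ℂ) = (b 0 : ℂ) / (b 1 : ℂ) :=
      Complex.ext (by simp) (by simp [h])
    have := Fintype.linearIndependent_iff.1 hli ![1, -((b 0 : ℂ) / (b 1 : ℂ)).re] (by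
      simp only [Fin.sum_univ_two, Module.Basis.ofZLatticeBasis_apply, Matrix.cons_val_zero,
        Matrix.cons_val_one, Complex.real_smul, Complex.ofReal_neg, hr]
      field_simp
      simp) 0
    simp at this
  · exact key b h

open UpperHalfPlane ModularForm EisensteinSeries in
lemma tsum_latticeNonzero_s14 (Λ : AddSubgroup ℂ) (ω : ℂ) (τ : UpperHalfPlane)
    (e : (Fin 2 → ℤ) ≃ Λ) (he : ∀ v, (e v : ℂ) = ω * (v 0 * (τ : ℂ) + v 1))
    {k : ℕ} (hk : 3 ≤ k) :
    ∑' x : latticeNonzero Λ, (x.1 ^ k)⁻¹ =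
      (ω ^ k)⁻¹ * (2 * riemannZeta k * E hk τ) := by
  let i : latticeNonzero Λ → Λ := fun x => ⟨x.1, x.2.1⟩
  have hi : Function.Injective i := fun x y h => Subtype.ext (congrArg (fun z : Λ => (z : ℂ)) h)
  have h1 : ∑' x : latticeNonzero Λ, (x.1 ^ k)⁻¹ = ∑' x : Λ, ((x : ℂ) ^ k)⁻¹ := by
    refine hi.tsum_eq (f := fun x : Λ => ((x : ℂ) ^ k)⁻¹) ?_
    intro x hx
    refine ⟨⟨x, x.2, fun h => hx ?_⟩, rfl⟩
    simp [h, show k ≠ 0 by omega]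
  rw [h1, ← e.tsum_eq]
  have h2 : ∀ v, ((e v : ℂ) ^ k)⁻¹ = (ω ^ k)⁻¹ * eisSummand k v τ := by
    intro v
    simp [he, eisSummand, mul_pow]
    ring
  simp_rw [h2]
  rw [tsum_mul_left, tsum_eisSummand_eq_riemannZeta_mul_eisensteinSeries hk]
  have : E hk τ = (1 / 2 : ℂ) * eisensteinSeries (N := 1) 0 k τ := rfl
  rw [this]
  ring

lemma zeta_six : riemannZeta 6 = (Real.pi : ℂ) ^ 6 / 945 := by
  have h := riemannZeta_two_mul_nat (k := 3) (by norm_num)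
  have hb : bernoulli 6 = 1 / 42 := by
    rw [bernoulli_eq_bernoulli'_of_ne_one (by norm_num), bernoulli'_def]
    norm_num [Finset.sum_range_succ, Nat.choose, bernoulli'_eq_zero_of_odd (n := 5)
      (by decide) (by norm_num)]
  norm_num [hb, Nat.factorial] at h
  rw [h]
  ring

/-- Nonvanishing of the discriminant: for a lattice `Λ ⊆ ℂ`, the discriminant
`Δ(Λ) = g₂(Λ)³ − 27 g₃(Λ)²` is nonzero; equivalently the cubic
`4x³ − g₂(Λ)x − g₃(Λ)` has no repeated roots. -/
theorem discriminant_ne_zero (Λ : AddSubgroup ℂ) (hΛ : IsComplexLattice Λ) :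
    g2 Λ ^ 3 - 27 * g3 Λ ^ 2 ≠ 0 := by
  obtain ⟨ω, τ, e, hω, he⟩ := exists_param Λ hΛ
  have h4 := tsum_latticeNonzero_s14 Λ ω τ e he (k := 4) (by norm_num)
  have h6 := tsum_latticeNonzero_s14 Λ ω τ e he (k := 6) (by norm_num)
  have hΔ := ModularForm.discriminant_eq_E₄_cube_sub_E₆_sq τ
  have h0 := ModularForm.discriminant_ne_zero τ
  push_cast at h4 h6
  rw [riemannZeta_four] at h4
  rw [zeta_six] at h6
  have hpi : (Real.pi : ℂ) ≠ 0 := by exact_mod_cast Real.pi_ne_zero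
  have : g2 Λ ^ 3 - 27 * g3 Λ ^ 2 =
      (64 * Real.pi ^ 12 / 27 * (ω ^ 12)⁻¹ * 1728) * ModularForm.discriminant τ := by
    rw [g2, g3, h4, h6, hΔ]
    field_simp
    ring
  rw [this]
  exact mul_ne_zero (by simp [hω, hpi]) h0
end
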